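/- arXiv:1607.05237 — 4 statements merged into one kernel-verified Lean document; each statement's English description precedes it below -/
import Mathlib

section
/- For every k : ℕ, G : List τ → σ, H : List τ → (τ → σ) → σ and s : List τ, the functional Ψ satisfies: if |s| > k then Ψ k G H s = G s, and if |s| ≤ k then Ψ k G H s = H s (fun x => Ψ k G H (s*x)). Equivalently, for every k, Ψ k satisfies Spector's bar-recursion equation for the constant functional Y = fun α => k. (Lemma 2.1: bar recursion with constant stopping functional is primitive recursively definable.) -/
/-- Extension of a finite sequence `s` by infinitely many copies of `z` (the "hat"). -/
def ext {τ : Type*} (z : τ) (s : List τ) : ℕ → τ := fun n => s.getD n z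

/-- Concatenation `s * β` of a finite sequence with an infinite one. -/
def cat {τ : Type*} (s : List τ) (β : ℕ → τ) : ℕ → τ :=
  fun n => if h : n < s.length then s[n] else β (n - s.length)

/-- `S` is a bar: decidable, monotone, and hit by every infinite sequence. -/
def IsBar {τ : Type*} (S : List τ → Prop) : Prop :=
  (∀ s, S s ∨ ¬ S s) ∧ (∀ s t : List τ, S s → S (s ++ t)) ∧
    (∀ α : ℕ → τ, ∃ n : ℕ, S ((List.range n).map α))

/-- `S` secures `Y`: whenever `S s` holds, `fun β => Y (s * β)` is constant. -/
def Secures {τ : Type*} (S : List τ → Prop) (Y : (ℕ → τ) → ℕ) : Prop :=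
  ∀ s, S s → ∀ β β' : ℕ → τ, Y (cat s β) = Y (cat s β')

/-- The general bar-recursion equation for the bar `S`. -/
def GenBR {τ σ : Type*} (S : List τ → Prop)
    (Δ : (List τ → σ) → (List τ → (τ → σ) → σ) → List τ → σ) : Prop :=
  ∀ G H s, (S s → Δ G H s = G s) ∧
    (¬ S s → Δ G H s = H s (fun x => Δ G H (s ++ [x])))

/-- Spector's bar-recursion equation for the stopping functional `Y`. -/
def SpectorBR {τ σ : Type*} (z : τ) (Y : (ℕ → τ) → ℕ)
    (ξ : (List τ → σ) → (List τ → (τ → σ) → σ) → List τ → σ) : Prop :=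
  ∀ G H s, (Y (ext z s) < s.length → ξ G H s = G s) ∧
    (s.length ≤ Y (ext z s) → ξ G H s = H s (fun x => ξ G H (s ++ [x])))

/-- The auxiliary functional `φ`. -/
def phi {τ σ : Type*} (G : List τ → σ) (H : List τ → (τ → σ) → σ) : ℕ → List τ → σ
  | 0 => G
  | n + 1 => fun s => H s (fun x => phi G H n (s ++ [x]))

/-- The functional `Ψ`, bar recursion for a constant stopping functional. -/
def psi {τ σ : Type*} (k : ℕ) (G : List τ → σ) (H : List τ → (τ → σ) → σ)
    (s : List τ) : σ :=
  if s.length > k then G s else phi G H (k + 1 - s.length) s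

theorem psi_of_lt_length {τ σ : Type*} {k : ℕ} (G : List τ → σ)
    (H : List τ → (τ → σ) → σ) {s : List τ} (h : k < s.length) : psi k G H s = G s :=
  if_pos h

theorem psi_of_length_le {τ σ : Type*} {k : ℕ} (G : List τ → σ)
    (H : List τ → (τ → σ) → σ) {s : List τ} (h : s.length ≤ k) :
    psi k G H s = phi G H (k + 1 - s.length) s :=
  if_neg (not_lt.mpr h)

/-- One step past a sequence of length at most `k`, `psi` is still given by `phi`, including at
length `k + 1`, where `phi` has index `0`. -/
theorem psi_append_singleton {τ σ : Type*} {k : ℕ} (G : List τ → σ)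
    (H : List τ → (τ → σ) → σ) {s : List τ} (h : s.length ≤ k) (x : τ) :
    psi k G H (s ++ [x]) = phi G H (k - s.length) (s ++ [x]) := by
  rcases h.eq_or_lt with rfl | h
  · rw [psi_of_lt_length G H (by simp), Nat.sub_self, phi]
  · rw [psi_of_length_le G H (by simpa using h), List.length_append, List.length_singleton,
      Nat.add_sub_add_right]

theorem psi_eq_of_length_le {τ σ : Type*} {k : ℕ} (G : List τ → σ)
    (H : List τ → (τ → σ) → σ) {s : List τ} (h : s.length ≤ k) :
    psi k G H s = H s (fun x => psi k G H (s ++ [x])) := by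
  simp only [psi_append_singleton G H h]
  rw [psi_of_length_le G H h, Nat.succ_sub h, phi]

/-- Lemma 2.1: for every `k`, `Ψ k` satisfies the defining equations of bar recursion
with the constant stopping functional `Y = fun _ => k`. -/
theorem psi_bar_recursion_constant {τ σ : Type*} (z : τ) (k : ℕ) :
    (∀ (G : List τ → σ) (H : List τ → (τ → σ) → σ) (s : List τ),
      (s.length > k → psi k G H s = G s) ∧
      (s.length ≤ k → psi k G H s = H s (fun x => psi k G H (s ++ [x])))) ∧
    SpectorBR z (fun _ => k) (psi k : (List τ → σ) → (List τ → (τ → σ) → σ) → List τ → σ) := by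
  exact ⟨fun G H _ => ⟨psi_of_lt_length G H, psi_eq_of_length_le G H⟩,
    fun G H _ => ⟨psi_of_lt_length G H, psi_eq_of_length_le G H⟩⟩
end

section
/- For every simple finite type η (built only from ℕ and →), level(η°) = 2 + max(1 + level τ, level σ) + level η. (Lemma 3.2: type level of the translated types.) -/
/-- Finite types: `ℕ`, function types, product types, and finite-sequence types. -/
inductive FinType where
  | nat : FinType
  | arr : FinType → FinType → FinType
  | prod : FinType → FinType → FinType
  | star : FinType → FinType

/-- The level of a finite type. -/
def FinType.level : FinType → ℕ
  | .nat => 0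
  | .arr a b => max (1 + a.level) b.level
  | .prod a b => max a.level b.level
  | .star a => a.level

/-- Simple finite types, built only from `ℕ` and `→`. -/
inductive Ty where
  | nat : Ty
  | arr : Ty → Ty → Ty

/-- Embedding of simple finite types into finite types. -/
def Ty.toFinType : Ty → FinType
  | .nat => .nat
  | .arr a b => .arr a.toFinType b.toFinType

/-- The translation `η ↦ η°` of simple finite types, for fixed `τ` and `σ`:
`ℕ° = ((ℕ → τ) → ℕ) × ((τ* → σ) → (τ* → (τ → σ) → σ) → τ* → σ)` and
`(ρ₀ → ρ₁)° = ρ₀° → ρ₁°`. -/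
def Ty.circ (τ σ : FinType) : Ty → FinType
  | .nat => .prod (.arr (.arr .nat τ) .nat)
      (.arr (.arr (.star τ) σ) (.arr (.arr (.star τ) (.arr (.arr τ σ) σ)) (.arr (.star τ) σ)))
  | .arr a b => .arr (a.circ τ σ) (b.circ τ σ)

/-- Lemma 3.2: `level (η°) = 2 + max (1 + level τ) (level σ) + level η`. -/
theorem level_circ (τ σ : FinType) (η : Ty) :
    (η.circ τ σ).level = 2 + max (1 + τ.level) σ.level + η.toFinType.level := by
  induction η with
  | nat => simp only [Ty.circ, Ty.toFinType, FinType.level]; omega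
  | arr a b iha ihb => simp only [Ty.circ, Ty.toFinType, FinType.level, iha, ihb]; omega
end

section
/- For every System T term t of type ρ whose free variables are x₁,…,xₙ and possibly the distinguished variable α : ℕ → ℕ, the semantics of the translated abstraction satisfies ⟦(λx₁…xₙ. t)°⟧ ∼ (fun α => ⟦λx₁…xₙ. t⟧ evaluated at α), where ∼ is the logical relation at the type of λx₁…xₙ. t. (Fundamental lemma of the logical relation in the proof of Theorem 3.3, case τ = ℕ.) -/
/-- Set-theoretic semantics of simple types. -/
def Ty.sem : Ty → Type
  | .nat => ℕ
  | .arr a b => a.sem → b.sem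

/-- Typed de Bruijn indices into a context. -/
inductive Idx {κ : Type} : List κ → κ → Type where
  | zero {Γ ρ} : Idx (ρ :: Γ) ρ
  | succ {Γ ρ η} : Idx Γ ρ → Idx (η :: Γ) ρ

/-- Semantic environments for a context. -/
def Env {κ : Type} (f : κ → Type*) : List κ → Type _
  | [] => PUnit
  | ρ :: Γ => f ρ × Env f Γ

/-- Looking up a variable in an environment. -/
def Idx.lookup {κ : Type} {f : κ → Type*} : ∀ {Γ : List κ} {ρ : κ}, Idx Γ ρ → Env f Γ → f ρ
  | _, _, .zero, e => e.1
  | _, _, .succ v, e => v.lookup e.2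

/-- Terms of Gödel's System T over the simple types, in a context `Γ`, with a
distinguished variable (constant) `alpha : ℕ → τv`, the constants `0`, `Succ`,
and the recursors `Rec^ℕ` and `Rec^{ρ → ℕ}` of the paper. -/
inductive Tm (τv : Ty) : List Ty → Ty → Type where
  | var {Γ ρ} : Idx Γ ρ → Tm τv Γ ρ
  | lam {Γ a b} : Tm τv (a :: Γ) b → Tm τv Γ (.arr a b)
  | app {Γ a b} : Tm τv Γ (.arr a b) → Tm τv Γ a → Tm τv Γ b
  | zero {Γ} : Tm τv Γ .nat
  | succ {Γ} : Tm τv Γ (.arr .nat .nat)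
  | alpha {Γ} : Tm τv Γ (.arr .nat τv)
  | recN {Γ} : Tm τv Γ (.arr .nat (.arr (.arr .nat (.arr .nat .nat)) (.arr .nat .nat)))
  | recA {Γ} (ρ : Ty) : Tm τv Γ (.arr (.arr ρ .nat)
      (.arr (.arr .nat (.arr (.arr ρ .nat) (.arr ρ .nat))) (.arr .nat (.arr ρ .nat))))

/-- Standard set-theoretic semantics of terms, parametrized by the value of `alpha`. -/
def Tm.sem {τv : Ty} : ∀ {Γ ρ}, Tm τv Γ ρ → (ℕ → τv.sem) → Env Ty.sem Γ → ρ.sem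
  | _, _, .var v, _, e => v.lookup e
  | _, _, .lam t, α, e => fun x => t.sem α (x, e)
  | _, _, .app u v, α, e => u.sem α e (v.sem α e)
  | _, _, .zero, _, _ => (0 : ℕ)
  | _, _, .succ, _, _ => Nat.succ
  | _, _, .alpha, α, _ => α
  | _, _, .recN, _, _ => fun a f n => Nat.rec (motive := fun _ => ℕ) a f n
  | _, _, .recA ρ, _, _ => fun a f n => Nat.rec (motive := fun _ => Ty.sem ρ → ℕ) a f n

/-- Semantics of the type translation `ρ ↦ ρ°` (case `τ = ℕ`), for result type `σS`:
`ℕ°` is interpreted by `((ℕ → ℕ) → ℕ) × ((ℕ* → σ) → (ℕ* → (ℕ → σ) → σ) → ℕ* → σ)`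
and `(ρ₀ → ρ₁)°` by functions. -/
def TyC (σS : Type*) : Ty → Type _
  | .nat => ((ℕ → ℕ) → ℕ) ×
      ((List ℕ → σS) → (List ℕ → (ℕ → σS) → σS) → List ℕ → σS)
  | .arr a b => TyC σS a → TyC σS b

/-- The interpretation of the numeral translation `k° = ⟨λα.k, λG H.G⟩`. -/
def kc (σS : Type*) (k : ℕ) : TyC σS .nat := ⟨fun _ => k, fun G _ => G⟩

/-- Semantics of the term translation `t ↦ t°` (case `τ = ℕ`), following
Definition 3.1 of the paper clause by clause. -/
def Tm.csem (σS : Type*) : ∀ {Γ ρ}, Tm .nat Γ ρ → Env (TyC σS) Γ → TyC σS ρ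
  | _, _, .var v, e => v.lookup e
  | _, _, .lam t, e => fun x => t.csem σS (x, e)
  | _, _, .app u v, e => u.csem σS e (v.csem σS e)
  | _, _, .zero, _ => ⟨fun _ => (0 : ℕ), fun G _ => G⟩
  | _, _, .succ, _ => fun x => ⟨fun α => Nat.succ (x.1 α), x.2⟩
  | _, _, .alpha, _ => fun x =>
      ⟨fun α => α (x.1 α),
       fun G H => x.2 (fun s' => psi (x.1 (ext 0 s')) G H s') H⟩
  | _, _, .recN, _ => fun a F x =>
      let r : ℕ → TyC σS .nat :=
        fun n => Nat.rec (motive := fun _ => TyC σS .nat) a (fun k ih => F (kc σS k) ih) n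
      ⟨fun α => (r (x.1 α)).1 α,
       fun G H s => x.2 (fun s' => (r (x.1 (ext 0 s'))).2 G H s') H s⟩
  | _, _, .recA ρ, _ => fun a F x v =>
      let r : ℕ → TyC σS (.arr ρ .nat) :=
        fun n => Nat.rec (motive := fun _ => TyC σS (.arr ρ .nat)) a (fun k ih => F (kc σS k) ih) n
      ⟨fun α => (r (x.1 α) v).1 α,
       fun G H s => x.2 (fun s' => (r (x.1 (ext 0 s')) v).2 G H s') H s⟩

/-- The logical relation `∼_ρ` between `⟦ρ°⟧` and `(ℕ → ℕ) → ⟦ρ⟧`. -/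
def LogRel (σS : Type*) : ∀ ρ : Ty, TyC σS ρ → ((ℕ → ℕ) → ρ.sem) → Prop
  | .nat, f, g => f.1 = g ∧
      ∃ S : List ℕ → Prop, IsBar S ∧ Secures S g ∧ GenBR S f.2
  | .arr a b, f, g => ∀ x y, LogRel σS a x y → LogRel σS b (f x) (fun α => g α (y α))

/-- The type `ρ₁ → ⋯ → ρₙ → ρ` of the `λ`-closure of a term in context `[ρ₁, …, ρₙ]`. -/
def arrows : List Ty → Ty → Ty
  | [], ρ => ρ
  | a :: Γ, ρ => arrows Γ (.arr a ρ)

/-- The `λ`-closure `λx₁…xₙ.t` of a term `t` with free variables `x₁, …, xₙ`. -/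
def Tm.lams {τv : Ty} : ∀ {Γ : List Ty} {ρ : Ty}, Tm τv Γ ρ → Tm τv [] (arrows Γ ρ)
  | [], _, t => t
  | a :: Γ, ρ, t => Tm.lams (Γ := Γ) (ρ := .arr a ρ) t.lam

theorem ext_eq_cat {τ : Type*} (z : τ) (s : List τ) : ext z s = cat s (fun _ => z) := by
  funext n
  by_cases h : n < s.length <;> simp [ext, cat, h]

theorem cat_append {τ : Type*} (s t : List τ) (β : ℕ → τ) :
    cat (s ++ t) β = cat s (cat t β) := by
  funext n
  simp only [cat, List.length_append, List.getElem_append]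
  split_ifs <;> first | rfl | omega | (congr 1; omega)

theorem cat_range_map {τ : Type*} (α : ℕ → τ) (n : ℕ) :
    cat ((List.range n).map α) (fun k => α (n + k)) = α := by
  funext k
  by_cases h : k < n
  · simp [cat, h]
  · simp [cat, h, Nat.add_sub_cancel' (Nat.le_of_not_lt h)]

theorem Secures.apply_cat {S : List ℕ → Prop} {Y : (ℕ → ℕ) → ℕ} (h : Secures S Y)
    {s : List ℕ} (hs : S s) (β : ℕ → ℕ) : Y (cat s β) = Y (ext 0 s) := by
  rw [ext_eq_cat]
  exact h s hs _ _

theorem Secures.apply_ext_append {S : List ℕ → Prop} {Y : (ℕ → ℕ) → ℕ} (h : Secures S Y)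
    {s : List ℕ} (hs : S s) (t : List ℕ) : Y (ext 0 (s ++ t)) = Y (ext 0 s) := by
  rw [ext_eq_cat 0 (s ++ t), cat_append, h.apply_cat hs]

theorem IsBar.mono_range {τ : Type*} {S : List τ → Prop} (h : IsBar S) {α : ℕ → τ} {m n : ℕ}
    (hmn : m ≤ n) (hm : S ((List.range m).map α)) : S ((List.range n).map α) := by
  obtain ⟨k, rfl⟩ := Nat.exists_eq_add_of_le hmn
  rw [List.range_add, List.map_append]
  exact h.2.1 _ _ hm

/-- Dependent composition of bars: first secure `X`, then use the bar indexed by its value. -/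
def bindBar (S : List ℕ → Prop) (X : (ℕ → ℕ) → ℕ) (T : ℕ → List ℕ → Prop) (s : List ℕ) : Prop :=
  S s ∧ T (X (ext 0 s)) s

theorem IsBar.bind {S : List ℕ → Prop} {X : (ℕ → ℕ) → ℕ} {T : ℕ → List ℕ → Prop}
    (hS : IsBar S) (hX : Secures S X) (hT : ∀ n, IsBar (T n)) : IsBar (bindBar S X T) := by
  refine ⟨fun s => em _, fun s t h => ⟨hS.2.1 _ _ h.1, ?_⟩, fun α => ?_⟩
  · rw [hX.apply_ext_append h.1]
    exact (hT _).2.1 _ _ h.2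
  · obtain ⟨m, hm⟩ := hS.2.2 α
    obtain ⟨n, hn⟩ := (hT (X α)).2.2 α
    have hmax := hS.mono_range (le_max_left m n) hm
    refine ⟨max m n, hmax, ?_⟩
    rw [← hX.apply_cat hmax, cat_range_map]
    exact (hT _).mono_range (le_max_right m n) hn

theorem Secures.bind {S : List ℕ → Prop} {X : (ℕ → ℕ) → ℕ} {T : ℕ → List ℕ → Prop}
    {R : ℕ → (ℕ → ℕ) → ℕ} (hX : Secures S X) (hR : ∀ n, Secures (T n) (R n)) :
    Secures (bindBar S X T) (fun α => R (X α) α) := by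
  intro s hs β β'
  simp only [hX.apply_cat hs.1]
  exact hR _ s hs.2 β β'

theorem GenBR.bind {σ : Type*} {S : List ℕ → Prop} {X : (ℕ → ℕ) → ℕ} {T : ℕ → List ℕ → Prop}
    {Δ : (List ℕ → σ) → (List ℕ → (ℕ → σ) → σ) → List ℕ → σ}
    {E : ℕ → (List ℕ → σ) → (List ℕ → (ℕ → σ) → σ) → List ℕ → σ}
    (hS : IsBar S) (hX : Secures S X) (hΔ : GenBR S Δ) (hE : ∀ n, GenBR (T n) (E n)) :
    GenBR (bindBar S X T) (fun G H s => Δ (fun s' => E (X (ext 0 s')) G H s') H s) := by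
  refine fun G H s => ⟨fun hs => ?_, fun hs => ?_⟩
  · exact ((hΔ _ H s).1 hs.1).trans ((hE _ G H s).1 hs.2)
  · by_cases h : S s
    · have hT : ¬ T (X (ext 0 s)) s := fun hT => hs ⟨h, hT⟩
      refine ((hΔ _ H s).1 h).trans (((hE _ G H s).2 hT).trans ?_)
      congr 1
      funext x
      refine Eq.trans ?_ ((hΔ _ H (s ++ [x])).1 (hS.2.1 _ _ h)).symm
      rw [hX.apply_ext_append h]
    · exact (hΔ _ H s).2 h

theorem genBR_psi {τ σ : Type*} (k : ℕ) :
    GenBR (fun s : List τ => k < s.length) (psi (σ := σ) k) := by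
  refine fun G H s => ⟨fun h => if_pos h, fun h => ?_⟩
  obtain ⟨d, rfl⟩ := Nat.exists_eq_add_of_le (Nat.le_of_not_lt h)
  have h₁ : s.length + d + 1 - s.length = d + 1 := by omega
  simp only [psi, gt_iff_lt, if_neg h, h₁, phi]
  congr 1
  funext x
  by_cases hd : s.length + d < (s ++ [x]).length
  · obtain rfl : d = 0 := by simp at hd; omega
    simp [phi]
  · rw [if_neg hd]
    congr 1
    simp

theorem isBar_length {τ : Type*} (k : ℕ) : IsBar (fun s : List τ => k < s.length) := by
  refine ⟨fun s => em _, fun s t h => ?_, fun α => ⟨k + 1, by simp⟩⟩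
  simp only [List.length_append]
  omega

theorem secures_length_eval (k : ℕ) :
    Secures (fun s : List ℕ => k < s.length) (fun α => α k) := by
  intro s hs β β'
  simp only [cat, dif_pos hs]

theorem LogRel.const (σS : Type*) (k : ℕ) : LogRel σS .nat (kc σS k) (fun _ => k) :=
  ⟨rfl, fun _ => True, ⟨fun _ => em _, fun _ _ _ => trivial, fun _ => ⟨0, trivial⟩⟩,
    fun _ _ _ _ => rfl, fun _ _ _ => ⟨fun _ => rfl, fun h => (h trivial).elim⟩⟩

theorem LogRel.bind {σS : Type*} {x : TyC σS .nat} {X : (ℕ → ℕ) → ℕ}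
    (hx : LogRel σS .nat x X) {r : ℕ → TyC σS .nat} {R : ℕ → (ℕ → ℕ) → ℕ}
    (hr : ∀ n, LogRel σS .nat (r n) (R n)) :
    LogRel σS .nat
      ⟨fun α => (r (x.1 α)).1 α,
        fun G H s => x.2 (fun s' => (r (x.1 (ext 0 s'))).2 G H s') H s⟩
      (fun α => R (X α) α) := by
  obtain ⟨rfl, S, hS, hX, hΔ⟩ := hx
  choose hval T hT hR hE using hr
  refine ⟨?_, bindBar S x.1 T, hS.bind hX hT, hX.bind hR, hΔ.bind hS hX hE⟩
  funext α
  exact congrFun (hval (x.1 α)) α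

theorem LogRel.alpha (σS : Type*) (k : ℕ) :
    LogRel σS .nat ⟨fun α => α k, psi k⟩ (fun α => α k) :=
  ⟨rfl, _, isBar_length k, secures_length_eval k, genBR_psi k⟩

theorem LogRel.succ {σS : Type*} {x : TyC σS .nat} {X : (ℕ → ℕ) → ℕ}
    (hx : LogRel σS .nat x X) :
    LogRel σS .nat ⟨fun α => Nat.succ (x.1 α), x.2⟩ (fun α => Nat.succ (X α)) := by
  obtain ⟨rfl, S, hS, hX, hΔ⟩ := hx
  exact ⟨rfl, S, hS, fun s hs β β' => congrArg Nat.succ (hX s hs β β'), hΔ⟩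

theorem LogRel.natRec {σS : Type*} {η : Ty} {a : TyC σS η} {A : (ℕ → ℕ) → η.sem}
    (ha : LogRel σS η a A)
    {F : TyC σS (.arr .nat (.arr η η))} {Φ : (ℕ → ℕ) → (Ty.arr .nat (.arr η η)).sem}
    (hF : LogRel σS (.arr .nat (.arr η η)) F Φ) (n : ℕ) :
    LogRel σS η (Nat.rec (motive := fun _ => TyC σS η) a (fun k ih => F (kc σS k) ih) n)
      (fun α => Nat.rec (motive := fun _ => η.sem) (A α) (Φ α) n) := by
  induction n with
  | zero => exact ha
  | succ k ih => exact hF _ _ (LogRel.const σS k) _ _ ih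

/-- Pointwise logical relation between environments. -/
def EnvRel (σS : Type*) (Γ : List Ty) (e : Env (TyC σS) Γ) (E : (ℕ → ℕ) → Env Ty.sem Γ) : Prop :=
  ∀ ρ (v : Idx Γ ρ), LogRel σS ρ (v.lookup e) (fun α => v.lookup (E α))

theorem EnvRel.cons {σS : Type*} {Γ : List Ty} {e : Env (TyC σS) Γ}
    {E : (ℕ → ℕ) → Env Ty.sem Γ} (h : EnvRel σS Γ e E) {a : Ty} {x : TyC σS a}
    {y : (ℕ → ℕ) → a.sem} (hxy : LogRel σS a x y) :
    EnvRel σS (a :: Γ) (x, e) (fun α => (y α, E α)) := by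
  intro ρ v
  cases v with
  | zero => exact hxy
  | succ v => exact h ρ v

theorem Tm.logRel (σS : Type*) {Γ : List Ty} {ρ : Ty} (t : Tm .nat Γ ρ) :
    ∀ (e : Env (TyC σS) Γ) (E : (ℕ → ℕ) → Env Ty.sem Γ), EnvRel σS Γ e E →
      LogRel σS ρ (t.csem σS e) (fun α => t.sem α (E α)) := by
  induction t with
  | var v => exact fun e E h => h _ v
  | lam t ih => exact fun e E h x y hxy => ih _ _ (h.cons hxy)
  | app u v ihu ihv => exact fun e E h => ihu e E h _ _ (ihv e E h)
  | zero => exact fun e E h => LogRel.const σS 0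
  | succ => exact fun e E h x y hxy => hxy.succ
  | alpha => exact fun e E h x y hxy => hxy.bind (LogRel.alpha σS)
  | recN =>
    exact fun e E h a A ha F Φ hF x X hx => hx.bind (LogRel.natRec ha hF)
  | recA ρ =>
    exact fun e E h a A ha F Φ hF x X hx v V hv =>
      hx.bind (fun n => LogRel.natRec ha hF n v V hv)

/-- Fundamental lemma of the logical relation (case `τ = ℕ`): for every System T term
`t` of type `ρ` with free variables `x₁, …, xₙ` and possibly `α : ℕ → ℕ`,
`⟦(λx₁…xₙ.t)°⟧ ∼ fun α => ⟦λx₁…xₙ.t⟧(α)`. -/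
theorem fundamental_lemma (σS : Type*) (Γ : List Ty) (ρ : Ty) (t : Tm .nat Γ ρ) :
    LogRel σS (arrows Γ ρ) ((t.lams).csem σS PUnit.unit)
      (fun α => (t.lams).sem α PUnit.unit) := by
  refine Tm.logRel σS t.lams PUnit.unit (fun _ => PUnit.unit) ?_
  intro ρ v
  cases v
end

section
/- Let τ = ℕ → ℕ with 0_τ the constant-zero function, and let g, h : (ℕ → (ℕ → ℕ)) → ℕ. Suppose S_x is a bar securing g with B_x satisfying GenBR_{S_x}(B_x), and S_y is a bar securing h with B_y satisfying GenBR_{S_y}(B_y). Define S s := S_x s ∧ S_y s ∧ max (g ŝ) (h ŝ) < |s| and Δ G H s := B_y (B_x (fun s' => Ψ (max (g ŝ') (h ŝ')) G H s') H) H s. Then Δ satisfies GenBR_S(Δ). (General bar-recursion equation for the α-case when τ = ℕ → ℕ, Section 3.4.) -/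
theorem ext_append_eq_cat {τ : Type*} (z : τ) (s t : List τ) :
    ext z (s ++ t) = cat s (ext z t) := by
  funext n
  by_cases hn : n < s.length
  · simp [ext, cat, hn, List.getElem?_append_left hn]
  · simp [ext, cat, hn, List.getElem?_append_right (not_lt.mp hn)]

/-- A secured functional does not see extensions of a secured sequence. -/
theorem Secures.ext_append {τ : Type*} {S : List τ → Prop} {Y : (ℕ → τ) → ℕ}
    (hS : Secures S Y) (z : τ) {s : List τ} (hs : S s) (t : List τ) :
    Y (ext z (s ++ t)) = Y (ext z s) := by
  rw [ext_append_eq_cat, ext_eq_cat z s]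
  exact hS s hs _ _

theorem psi_of_lt {τ σ : Type*} {k : ℕ} (G : List τ → σ) (H : List τ → (τ → σ) → σ)
    {s : List τ} (hs : k < s.length) : psi k G H s = G s :=
  if_pos hs

theorem psi_of_le {τ σ : Type*} {k : ℕ} (G : List τ → σ) (H : List τ → (τ → σ) → σ)
    {s : List τ} (hs : s.length ≤ k) :
    psi k G H s = H s (fun x => psi k G H (s ++ [x])) := by
  obtain ⟨m, rfl⟩ := Nat.exists_eq_add_of_le hs
  have hm : s.length + m + 1 - s.length = m + 1 := by omega
  rw [psi, if_neg (not_lt.mpr hs), hm, phi]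
  refine congrArg (H s) (funext fun x => ?_)
  rcases m with _ | m
  · rw [psi_of_lt G H (by simp), phi]
  · have hlen : s.length + (m + 1) + 1 - (s ++ [x]).length = m + 1 := by simp
    rw [psi, if_neg (by simp), hlen]

/-- General bar-recursion equation for the `α`-case when `τ = ℕ → ℕ` (Section 3.4),
with `0_τ` the constant-zero function: if `S_x` is a bar securing `g` with
`GenBR_{S_x}(B_x)` and `S_y` a bar securing `h` with `GenBR_{S_y}(B_y)`, then
`Δ G H s := B_y (B_x (fun s' => Ψ (max (g ŝ') (h ŝ')) G H s') H) H s` satisfies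
`GenBR_S(Δ)` where `S s := S_x s ∧ S_y s ∧ max (g ŝ) (h ŝ) < |s|`. -/
theorem alpha_case_genBR_fn {σ : Type*} (g h : (ℕ → (ℕ → ℕ)) → ℕ)
    (Sx Sy : List (ℕ → ℕ) → Prop)
    (hbarx : IsBar Sx) (hsecx : Secures Sx g)
    (hbary : IsBar Sy) (hsecy : Secures Sy h)
    (Bx By : (List (ℕ → ℕ) → σ) → (List (ℕ → ℕ) → ((ℕ → ℕ) → σ) → σ) → List (ℕ → ℕ) → σ)
    (hBx : GenBR Sx Bx) (hBy : GenBR Sy By) :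
    GenBR (fun s : List (ℕ → ℕ) =>
        Sx s ∧ Sy s ∧ max (g (ext (fun _ => 0) s)) (h (ext (fun _ => 0) s)) < s.length)
      (fun G H s =>
        By (Bx (fun s' => psi (max (g (ext (fun _ => 0) s')) (h (ext (fun _ => 0) s')))
            G H s') H) H s) := by
  intro G H s
  set k : List (ℕ → ℕ) → ℕ := fun s => max (g (ext (fun _ => 0) s)) (h (ext (fun _ => 0) s))
    with hk
  set P : List (ℕ → ℕ) → σ := fun s' => psi (k s') G H s' with hP
  change (Sx s ∧ Sy s ∧ k s < s.length → By (Bx P H) H s = G s) ∧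
    (¬(Sx s ∧ Sy s ∧ k s < s.length) →
      By (Bx P H) H s = H s (fun x => By (Bx P H) H (s ++ [x])))
  refine ⟨fun ⟨hx, hy, hlt⟩ => ?_, fun hS => ?_⟩
  · rw [(hBy _ H s).1 hy, (hBx P H s).1 hx]
    exact psi_of_lt G H hlt
  by_cases hy : Sy s
  · have hBy' (x : ℕ → ℕ) : By (Bx P H) H (s ++ [x]) = Bx P H (s ++ [x]) :=
      (hBy _ H _).1 (hbary.2.1 s [x] hy)
    simp only [hBy', (hBy _ H s).1 hy]
    by_cases hx : Sx s
    · have hle : s.length ≤ k s := not_lt.mp fun hlt => hS ⟨hx, hy, hlt⟩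
      have hBx' (x : ℕ → ℕ) : Bx P H (s ++ [x]) = P (s ++ [x]) :=
        (hBx P H _).1 (hbarx.2.1 s [x] hx)
      have hkx (x : ℕ → ℕ) : k (s ++ [x]) = k s := by
        simp only [hk, hsecx.ext_append _ hx, hsecy.ext_append _ hy]
      simp only [hBx', (hBx P H s).1 hx]
      simp only [hP, hkx]
      exact psi_of_le G H hle
    · exact (hBx P H s).2 hx
  · exact (hBy _ H s).2 hy
end
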